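/- arXiv:2505.05502 — 3 statements merged into one kernel-verified Lean document; each statement's English description precedes it below -/
import Mathlib

section
/- The set 𝒰 = {u ∈ ℝ^m : A_i ⬝ u ≤ B_i for all i = 1, …, c} is nonempty if and only if the set S = {−B ⬝ λ : λ ∈ Λ} ⊆ ℝ is bounded above. -/
open Matrix

/-- **Farkas' lemma** for finitely many linear functionals: if `g` is nonpositive wherever all the
`f i` are, then `g` is a nonnegative combination of the `f i`. -/
theorem Module.Dual.exists_nonneg_sum_eq_of_nonpos {K V ι : Type*} [Field K] [LinearOrder K]
    [IsStrictOrderedRing K] [AddCommGroup V] [Module K V] (s : Finset ι)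
    (f : ι → Module.Dual K V) (g : Module.Dual K V)
    (h : ∀ x, (∀ i ∈ s, f i x ≤ 0) → g x ≤ 0) :
    ∃ l : ι → K, (∀ i, 0 ≤ l i) ∧ ∀ x, g x = ∑ i ∈ s, l i * f i x := by
  classical
  induction s using Finset.induction_on generalizing f g with
  | empty =>
    refine ⟨0, fun _ => le_rfl, fun x => ?_⟩
    have h₁ := h x (by simp)
    have h₂ := h (-x) (by simp)
    rw [map_neg] at h₂
    simp only [Finset.sum_empty]
    linarith
  | insert a s ha ih =>
    have sum_update (l : ι → K) (r : K) (x : V) :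
        ∑ i ∈ insert a s, Function.update l a r i * f i x = r * f a x + ∑ i ∈ s, l i * f i x := by
      rw [Finset.sum_insert ha, Function.update_self]
      congr 1
      refine Finset.sum_congr rfl fun i hi => ?_
      rw [Function.update_of_ne (ne_of_mem_of_not_mem hi ha)]
    have update_nonneg {l : ι → K} {r : K} (hl : ∀ i, 0 ≤ l i) (hr : 0 ≤ r) (i : ι) :
        0 ≤ Function.update l a r i := by
      rcases eq_or_ne i a with rfl | hi
      · simpa using hr
      · simpa [hi] using hl i
    by_cases hs : ∀ x, (∀ i ∈ s, f i x ≤ 0) → g x ≤ 0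
    · obtain ⟨l, hl, hgl⟩ := ih f g hs
      exact ⟨Function.update l a 0, update_nonneg hl le_rfl, fun x => by
        rw [sum_update, hgl, zero_mul, zero_add]⟩
    · push Not at hs
      obtain ⟨y, hy, hgy⟩ := hs
      have hay : 0 < f a y := by
        by_contra! hay
        exact hgy.not_ge (h y (by simpa [hay] using hy))
      obtain ⟨l, hl, hgl⟩ := ih (fun i => f i - (f i y / f a y) • f a) (g - (g y / f a y) • f a)
        (fun x hx => by
          have key := h (x - (f a x / f a y) • y) (by
            intro i hi
            rcases Finset.mem_insert.mp hi with rfl | hi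
            · simp [hay.ne']
            · have := hx i hi
              simp only [LinearMap.sub_apply, LinearMap.smul_apply, map_sub, map_smul,
                smul_eq_mul] at this ⊢
              convert this using 2
              ring)
          simp only [LinearMap.sub_apply, LinearMap.smul_apply, map_sub, map_smul,
            smul_eq_mul] at key ⊢
          convert key using 2
          ring)
      refine ⟨Function.update l a (g y / f a y - ∑ i ∈ s, l i * (f i y / f a y)),
        update_nonneg hl ?_, fun x => ?_⟩
      · have : ∑ i ∈ s, l i * (f i y / f a y) ≤ 0 := Finset.sum_nonpos fun i hi =>
          mul_nonpos_of_nonneg_of_nonpos (hl i) (div_nonpos_of_nonpos_of_nonneg (hy i hi) hay.le)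
        have := div_pos hgy hay
        linarith
      · have := hgl x
        simp only [LinearMap.sub_apply, LinearMap.smul_apply, smul_eq_mul, mul_sub,
          Finset.sum_sub_distrib, ← mul_assoc, ← Finset.sum_mul] at this
        rw [sum_update, sub_mul]
        linarith

/-- **Gale's theorem of the alternative**: an infeasible system `Aᵀ u ≤ B` of linear inequalities
has a certificate of infeasibility. -/
theorem Matrix.exists_mulVec_eq_zero_of_forall_not_le {K m n : Type*} [Field K] [LinearOrder K]
    [IsStrictOrderedRing K] [Fintype m] [Fintype n] (A : Matrix m n K) (B : n → K)
    (h : ∀ u, ¬ ∀ i, (Aᵀ *ᵥ u) i ≤ B i) :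
    ∃ l : n → K, (∀ i, 0 ≤ l i) ∧ A *ᵥ l = 0 ∧ B ⬝ᵥ l = -1 := by
  classical
  obtain ⟨l, hl, hgl⟩ := Module.Dual.exists_nonneg_sum_eq_of_nonpos Finset.univ
    (fun i => LinearMap.proj i ∘ₗ Aᵀ.mulVecLin ∘ₗ LinearMap.fst K (m → K) K
      - B i • LinearMap.snd K (m → K) K) (LinearMap.snd K (m → K) K) (by
    rintro ⟨u, t⟩ hut
    by_contra! ht
    replace ht : 0 < t := ht
    refine h (t⁻¹ • u) fun i => ?_
    have := hut i (Finset.mem_univ i)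
    simp only [LinearMap.sub_apply, LinearMap.smul_apply, LinearMap.comp_apply,
      LinearMap.fst_apply, LinearMap.snd_apply, LinearMap.proj_apply, mulVecLin_apply,
      smul_eq_mul, sub_nonpos] at this
    rw [mulVec_smul, Pi.smul_apply, smul_eq_mul, inv_mul_le_iff₀ ht, mul_comm]
    exact this)
  refine ⟨l, hl, ?_, ?_⟩
  · ext j
    have := hgl (Pi.single j 1, 0)
    simp only [LinearMap.sub_apply, LinearMap.smul_apply, LinearMap.comp_apply,
      LinearMap.fst_apply, LinearMap.snd_apply, LinearMap.proj_apply, mulVecLin_apply,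
      smul_eq_mul, mul_zero, sub_zero, mulVec_single_one, col_apply, transpose_apply] at this
    rw [Pi.zero_apply, this, mulVec, dotProduct_comm, dotProduct]
  · have := hgl (0, 1)
    simp only [LinearMap.sub_apply, LinearMap.smul_apply, LinearMap.comp_apply,
      LinearMap.fst_apply, LinearMap.snd_apply, LinearMap.proj_apply, mulVecLin_apply,
      smul_eq_mul, mul_one, mulVec_zero, Pi.zero_apply, zero_sub, mul_neg,
      Finset.sum_neg_distrib] at this
    rw [dotProduct_comm, dotProduct, this, neg_neg]

/-- `𝒰 = {u : A_i ⬝ u ≤ B_i ∀ i}` is nonempty iff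
`S = {-B ⬝ λ : λ ∈ Λ}` is bounded above. -/
theorem stmt_1 (m c : ℕ) (hm : 0 < m) (hc : 0 < c)
    (A : Matrix (Fin m) (Fin c) ℝ) (B : Fin c → ℝ)
    (Λ : Set (Fin c → ℝ))
    (hΛ : Λ = {l : Fin c → ℝ | A.mulVec l = 0 ∧ ∀ i, 0 ≤ l i})
    (S : Set ℝ) (hS : S = {x : ℝ | ∃ l ∈ Λ, x = -(B ⬝ᵥ l)})
    (U : Set (Fin m → ℝ))
    (hU : U = {u : Fin m → ℝ | ∀ i, Aᵀ.mulVec u i ≤ B i}) :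
    U.Nonempty ↔ BddAbove S := by
  subst hU hS hΛ
  constructor
  · rintro ⟨u, hu⟩
    refine ⟨0, ?_⟩
    rintro _ ⟨l, ⟨hAl, hl⟩, rfl⟩
    have key : Aᵀ *ᵥ u ⬝ᵥ l ≤ B ⬝ᵥ l := dotProduct_le_dotProduct_of_nonneg_right hu hl
    rw [mulVec_transpose, ← dotProduct_mulVec, hAl, dotProduct_zero] at key
    exact neg_nonpos.mpr key
  · rintro ⟨M, hM⟩
    by_contra hU
    obtain ⟨l, hl, hAl, hBl⟩ := exists_mulVec_eq_zero_of_forall_not_le A B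
      fun u hu => hU ⟨u, hu⟩
    have hr : 0 ≤ |M| + 1 := by positivity
    have := hM ⟨(|M| + 1) • l, ⟨by rw [mulVec_smul, hAl, smul_zero],
      fun i => mul_nonneg hr (hl i)⟩, rfl⟩
    rw [dotProduct_smul, hBl, smul_eq_mul, mul_neg_one, neg_neg] at this
    linarith [le_abs_self M]
end

section
/- The set 𝒰 = {u ∈ ℝ^m : A_i ⬝ u ≤ B_i for all i = 1, …, c} is nonempty if and only if 0 is the greatest element of the set S = {−B ⬝ λ : λ ∈ Λ} ⊆ ℝ (i.e., 0 ∈ S and −B ⬝ λ ≤ 0 for every λ ∈ Λ). -/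
open Matrix

/-- Farkas' lemma for finitely many linear functionals on a real vector space. -/
theorem exists_nonneg_sum_smul_eq_of_forall_nonpos {W : Type*} [AddCommGroup W] [Module ℝ W]
    (n : ℕ) (a : Fin n → W →ₗ[ℝ] ℝ) (b : W →ₗ[ℝ] ℝ)
    (h : ∀ x, (∀ i, a i x ≤ 0) → b x ≤ 0) :
    ∃ l : Fin n → ℝ, (∀ i, 0 ≤ l i) ∧ ∀ x, b x = ∑ i, l i * a i x := by
  induction n generalizing b with
  | zero =>
    refine ⟨0, fun i => i.elim0, fun x => ?_⟩
    have h₁ := h x fun i => i.elim0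
    have h₂ := h (-x) fun i => i.elim0
    rw [map_neg] at h₂
    simp only [Finset.univ_eq_empty, Finset.sum_empty]
    linarith
  | succ n ih =>
    by_cases hb : ∀ x, (∀ i : Fin n, a i.succ x ≤ 0) → b x ≤ 0
    · obtain ⟨l, hl, hlb⟩ := ih (fun i => a i.succ) b hb
      refine ⟨Fin.cons 0 l, Fin.cases (by simp) (by simpa using hl), fun x => ?_⟩
      simp [Fin.sum_univ_succ, hlb x]
    · push Not at hb
      obtain ⟨y, hy, hby⟩ := hb
      have hay : 0 < a 0 y := by
        by_contra! hneg
        exact absurd (h y (Fin.cases hneg hy)) (not_le.mpr hby)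
      -- Project onto the kernel of `a 0` along `y`.
      let p : W →ₗ[ℝ] W := LinearMap.id - ((a 0 y)⁻¹ • a 0).smulRight y
      have hp (f : W →ₗ[ℝ] ℝ) (x : W) : f (p x) = f x - (a 0 y)⁻¹ * a 0 x * f y := by
        simp [p]
      obtain ⟨l, hl, hlb⟩ := ih (fun i => a i.succ ∘ₗ p) (b ∘ₗ p) fun x hx =>
        h (p x) (Fin.cases (by rw [hp]; field_simp; simp) hx)
      refine ⟨Fin.cons ((a 0 y)⁻¹ * (b y - ∑ i, l i * a i.succ y)) l, ?_,
        fun x => ?_⟩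
      · refine Fin.cases ?_ (by simpa using hl)
        have hsum : ∑ i, l i * a i.succ y ≤ 0 :=
          Finset.sum_nonpos fun i _ => mul_nonpos_of_nonneg_of_nonpos (hl i) (hy i)
        exact mul_nonneg (inv_nonneg.mpr hay.le) (by linarith)
      · have hx := hlb x
        simp only [LinearMap.comp_apply, hp, mul_sub, Finset.sum_sub_distrib,
          mul_left_comm (l _), ← Finset.mul_sum] at hx
        simp only [Fin.sum_univ_succ, Fin.cons_zero, Fin.cons_succ]
        linear_combination hx

/-- `𝒰` is nonempty iff `0` is the greatest element of
`S = {-B ⬝ λ : λ ∈ Λ}` (i.e. `0 ∈ S` and `-B ⬝ λ ≤ 0` for every `λ ∈ Λ`). -/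
theorem stmt_2 (m c : ℕ) (hm : 0 < m) (hc : 0 < c)
    (A : Matrix (Fin m) (Fin c) ℝ) (B : Fin c → ℝ)
    (Λ : Set (Fin c → ℝ))
    (hΛ : Λ = {l : Fin c → ℝ | A.mulVec l = 0 ∧ ∀ i, 0 ≤ l i})
    (S : Set ℝ) (hS : S = {x : ℝ | ∃ l ∈ Λ, x = -(B ⬝ᵥ l)})
    (U : Set (Fin m → ℝ))
    (hU : U = {u : Fin m → ℝ | ∀ i, Aᵀ.mulVec u i ≤ B i}) :
    U.Nonempty ↔ ((0 : ℝ) ∈ S ∧ ∀ l ∈ Λ, -(B ⬝ᵥ l) ≤ 0) := by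
  subst hΛ hS hU
  have hdual (u : Fin m → ℝ) (l : Fin c → ℝ) : (Aᵀ *ᵥ u) ⬝ᵥ l = u ⬝ᵥ (A *ᵥ l) := by
    rw [mulVec_transpose, dotProduct_mulVec]
  constructor
  · rintro ⟨u, hu⟩
    refine ⟨⟨0, by simp, by simp⟩, fun l ⟨hAl, hl⟩ => ?_⟩
    have hle : (Aᵀ *ᵥ u) ⬝ᵥ l ≤ B ⬝ᵥ l :=
      Finset.sum_le_sum fun i _ => mul_le_mul_of_nonneg_right (hu i) (hl i)
    rw [hdual, hAl, dotProduct_zero] at hle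
    linarith
  · rintro ⟨-, hB⟩
    by_contra hU
    -- Homogenize: the functional `(u, t) ↦ t` is nonpositive on the homogenized system.
    let a (i : Fin c) : (Fin m → ℝ) × ℝ →ₗ[ℝ] ℝ :=
      (LinearMap.proj i ∘ₗ Aᵀ.mulVecLin) ∘ₗ LinearMap.fst ℝ _ _ - B i • LinearMap.snd ℝ _ _
    have ha (i : Fin c) (u : Fin m → ℝ) (t : ℝ) : a i (u, t) = (Aᵀ *ᵥ u) i - B i * t := by
      simp [a, mulVec_transpose]
    obtain ⟨l, hl, hlb⟩ := exists_nonneg_sum_smul_eq_of_forall_nonpos c a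
      (LinearMap.snd ℝ (Fin m → ℝ) ℝ) (by
        rintro ⟨u, t⟩ hut
        by_contra! ht
        replace ht : 0 < t := ht
        refine hU ⟨t⁻¹ • u, fun i => ?_⟩
        have hi := hut i
        rw [ha] at hi
        rw [mulVec_smul, Pi.smul_apply, smul_eq_mul, inv_mul_le_iff₀ ht]
        linarith)
    have hsum (u : Fin m → ℝ) (t : ℝ) : t = u ⬝ᵥ (A *ᵥ l) - (B ⬝ᵥ l) * t := by
      have h := hlb (u, t)
      simp only [LinearMap.snd_apply, ha] at h
      rw [← hdual, dotProduct, dotProduct, Finset.sum_mul, ← Finset.sum_sub_distrib]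
      exact h.trans (Finset.sum_congr rfl fun i _ => by ring)
    have hAl : A *ᵥ l = 0 := dotProduct_self_eq_zero.mp (by simpa using (hsum (A *ᵥ l) 0).symm)
    have hBl := hsum 0 1
    rw [zero_dotProduct] at hBl
    linarith [hB l ⟨hAl, hl⟩]
end

section
/- For any subset E ⊆ {1, …, c}, the set 𝒰'(E) = {u ∈ ℝ^m : A_i ⬝ u ≤ B_i for all i ∈ E} is nonempty if and only if there exists ν ∈ ℝ^c with Nᵀ ν = Nᵀ B and ν_i ≥ 0 for every i ∈ E. -/
open Matrix

/-- A vector orthogonal to the kernel of `A` lies in the range of `Aᵀ`. -/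
theorem exists_transpose_mulVec_eq {K m n : Type*} [Field K] [Fintype m] [Fintype n]
    (A : Matrix m n K) (w : n → K) (hw : ∀ l, A *ᵥ l = 0 → w ⬝ᵥ l = 0) :
    ∃ u : m → K, Aᵀ *ᵥ u = w := by
  classical
  have hmem : dotProductEquiv K n w ∈ A.mulVecLin.dualMap.range := by
    rw [LinearMap.range_dualMap_eq_dualAnnihilator_ker, Submodule.mem_dualAnnihilator]
    intro l hl
    exact hw l hl
  obtain ⟨g, hg⟩ := hmem
  obtain ⟨u, rfl⟩ := (dotProductEquiv K m).surjective g
  refine ⟨u, dotProduct_eq _ _ fun l => ?_⟩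
  have h : u ⬝ᵥ A *ᵥ l = w ⬝ᵥ l := LinearMap.congr_fun hg l
  rw [mulVec_transpose, ← dotProduct_mulVec, h]

/-- With `N` a `c×k` matrix whose columns span `null(A)`, for any subset `E`
of indices, `𝒰'(E)` is nonempty iff there exists `ν` with `Nᵀ ν = Nᵀ B` and `ν_i ≥ 0` for
every `i ∈ E`. -/
theorem stmt_9 (m c k : ℕ) (hm : 0 < m) (hc : 0 < c) (hk : 0 < k)
    (A : Matrix (Fin m) (Fin c) ℝ) (B : Fin c → ℝ)
    (N : Matrix (Fin c) (Fin k) ℝ)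
    (hN : {l : Fin c → ℝ | A.mulVec l = 0} = {l : Fin c → ℝ | ∃ μ : Fin k → ℝ, l = N.mulVec μ})
    (E : Finset (Fin c)) :
    (∃ u : Fin m → ℝ, ∀ i ∈ E, Aᵀ.mulVec u i ≤ B i) ↔
      ∃ ν : Fin c → ℝ, Nᵀ.mulVec ν = Nᵀ.mulVec B ∧ ∀ i ∈ E, 0 ≤ ν i := by
  constructor
  · rintro ⟨u, hu⟩
    have hAN : A * N = 0 := by
      refine ext_of_mulVec_single fun j => ?_
      rw [← mulVec_mulVec, zero_mulVec]
      exact hN.ge ⟨Pi.single j 1, rfl⟩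
    refine ⟨B - Aᵀ *ᵥ u, ?_, fun i hi => sub_nonneg.2 (hu i hi)⟩
    rw [mulVec_sub, mulVec_mulVec, ← transpose_mul, hAN, transpose_zero, zero_mulVec, sub_zero]
  · rintro ⟨ν, hν, hE⟩
    obtain ⟨u, hu⟩ := exists_transpose_mulVec_eq A (B - ν) fun l hl => by
      obtain ⟨μ, rfl⟩ := hN.le hl
      rw [dotProduct_mulVec, ← mulVec_transpose, mulVec_sub, hν, sub_self, zero_dotProduct]
    refine ⟨u, fun i hi => ?_⟩
    rw [hu]
    exact sub_le_self _ (hE i hi)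
end
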